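/- For every α ∈ (0,1), limsup_{n→∞} (1/n) · log ( sup { ‖p‖_{[−1,1]} / ‖p‖_{E_n} : p a real polynomial, p not identically zero, deg p ≤ α·n } ) ≤ C(α), where C(α) = ((1+α)·log(1+α) + (1−α)·log(1−α))/2. -/

import Mathlib

open MeasureTheory Polynomial Filter Set

/-- The `n`-grid: `n` equally spaced points in `[-1,1]` including the endpoints. -/
noncomputable def nGrid (n : ℕ) : Set ℝ :=
  {x | ∃ k : ℕ, 1 ≤ k ∧ k ≤ n ∧ x = (2 * (k : ℝ) - n - 1) / ((n : ℝ) - 1)}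

/-- Uniform norm of a real polynomial on the interval `[-1,1]`. -/
noncomputable def normI (p : Polynomial ℝ) : ℝ :=
  sSup ((fun x => |p.eval x|) '' Set.Icc (-1 : ℝ) 1)

/-- Uniform norm of a real polynomial on the `n`-grid. -/
noncomputable def normE (n : ℕ) (p : Polynomial ℝ) : ℝ :=
  sSup ((fun x => |p.eval x|) '' nGrid n)

/-- The constant `C(α)`. -/
noncomputable def Cconst (α : ℝ) : ℝ :=
  ((1 + α) * Real.log (1 + α) + (1 - α) * Real.log (1 - α)) / 2

/-- The discrete Chebyshev (Gram) polynomial of degree `n` for the nodes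
`-(N-1), -(N-3), …, N-1`, as a function, normalised to take the value `1` at `N + 1`. -/
noncomputable def gramFun (N : ℝ) : ℕ → ℝ → ℝ
  | 0, _ => 1
  | 1, s => s / (N + 1)
  | n + 2, s => ((2 * n + 3) * s * gramFun N (n + 1) s
      - (n + 1) * (N - (n + 1)) * gramFun N n s) / ((n + 2) * (N + (n + 2)))

theorem gramFun_zero (N s : ℝ) : gramFun N 0 s = 1 := by simp [gramFun]

theorem gramFun_one {N : ℝ} (hN : 0 ≤ N) (s : ℝ) : (N + 1) * gramFun N 1 s = s := by
  have : N + 1 ≠ 0 := by positivity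
  simp only [gramFun]
  field_simp

theorem gramFun_succ_succ {N : ℝ} (hN : 0 ≤ N) (n : ℕ) (s : ℝ) :
    ((n : ℝ) + 2) * (N + (n + 2)) * gramFun N (n + 2) s =
      (2 * n + 3) * s * gramFun N (n + 1) s - (n + 1) * (N - (n + 1)) * gramFun N n s := by
  have : ((n : ℝ) + 2) * (N + (n + 2)) ≠ 0 := by positivity
  rw [gramFun, mul_div_cancel₀ _ this]

theorem gramFun_energy_antitone {N : ℝ} (hN : 0 ≤ N) (n : ℕ) (s : ℝ) :
    (N + 1) * (gramFun N (n + 2) s ^ 2 + gramFun N (n + 1) s ^ 2)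
        - 2 * s * gramFun N (n + 2) s * gramFun N (n + 1) s ≤
      (N + 1) * (gramFun N (n + 1) s ^ 2 + gramFun N n s ^ 2)
        - 2 * s * gramFun N (n + 1) s * gramFun N n s := by
  have h := gramFun_succ_succ hN n s
  set A := gramFun N n s
  set B := gramFun N (n + 1) s
  set C := gramFun N (n + 2) s
  have hpos : (0 : ℝ) < 2 * n + 3 := by positivity
  have key : (2 * (n : ℝ) + 3) * (((N + 1) * (B ^ 2 + A ^ 2) - 2 * s * B * A)
      - ((N + 1) * (C ^ 2 + B ^ 2) - 2 * s * C * B)) =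
      (N + 2 * (n + 1) ^ 2 + 2 * (n + 1) + 1) * (A - C) ^ 2 := by
    linear_combination (2 * (A - C)) * h
  have : 0 ≤ (2 * (n : ℝ) + 3) * (((N + 1) * (B ^ 2 + A ^ 2) - 2 * s * B * A)
      - ((N + 1) * (C ^ 2 + B ^ 2) - 2 * s * C * B)) := by
    rw [key]; positivity
  have := nonneg_of_mul_nonneg_right this hpos
  linarith

theorem gramFun_energy_le {N : ℝ} (hN : 0 ≤ N) (n : ℕ) (s : ℝ) :
    (N + 1) * ((N + 1) * (gramFun N (n + 1) s ^ 2 + gramFun N n s ^ 2)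
        - 2 * s * gramFun N (n + 1) s * gramFun N n s) ≤ (N + 1) ^ 2 - s ^ 2 := by
  induction n with
  | zero =>
    have h := gramFun_one hN s
    simp only [zero_add, gramFun_zero]
    apply le_of_eq
    linear_combination ((N + 1) * gramFun N 1 s - s) * h
  | succ n ih =>
    exact (mul_le_mul_of_nonneg_left (gramFun_energy_antitone hN n s) (by positivity)).trans ih

theorem gramFun_sq_le_one {N : ℝ} (hN : 0 ≤ N) (n : ℕ) {s : ℝ} (hs : |s| ≤ N) :
    gramFun N n s ^ 2 ≤ 1 := by
  have h := gramFun_energy_le hN n s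
  have hs2 : s ^ 2 < (N + 1) ^ 2 := by
    rw [← sq_abs s]
    nlinarith [abs_nonneg s]
  nlinarith [sq_nonneg ((N + 1) * gramFun N (n + 1) s - s * gramFun N n s)]

theorem gramFun_backward {N : ℝ} (hN : 0 ≤ N) (n : ℕ) (s : ℝ) :
    (N ^ 2 - (s - 1) ^ 2) * (gramFun N n s - gramFun N n (s - 2)) =
      2 * (n + 1) * ((n + s) * gramFun N n s - (N + n + 1) * gramFun N (n + 1) s) ∧
    (N ^ 2 - (s - 1) ^ 2) * (gramFun N (n + 1) s - gramFun N (n + 1) (s - 2)) =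
      2 * (n + 1) * ((n + 2 - s) * gramFun N (n + 1) s + (N - (n + 1)) * gramFun N n s) := by
  induction n with
  | zero =>
    have h := gramFun_one hN s
    have h' := gramFun_one hN (s - 2)
    have hp : N + 1 ≠ 0 := by positivity
    simp only [zero_add, gramFun_zero, Nat.cast_zero]
    refine ⟨by linear_combination 2 * h, ?_⟩
    apply mul_left_cancel₀ hp
    linear_combination (N ^ 2 - (s - 1) ^ 2 - 2 * (2 - s)) * h - (N ^ 2 - (s - 1) ^ 2) * h'
  | succ n ih =>
    obtain ⟨h1, h2⟩ := ih
    have h := gramFun_succ_succ hN n s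
    have h' := gramFun_succ_succ hN n (s - 2)
    have hp : ((n : ℝ) + 2) * (N + (n + 2)) ≠ 0 := by positivity
    push_cast
    constructor
    · linear_combination h2 + 2 * h
    · apply mul_left_cancel₀ hp
      linear_combination (N ^ 2 - (s - 1) ^ 2 - 2 * (n + 2) * (n + 3 - s)) * h
        - (N ^ 2 - (s - 1) ^ 2) * h'
        + (2 * n + 3) * (s - 2) * h2 - (n + 1) * (N - (n + 1)) * h1

theorem gramFun_neg (N : ℝ) (n : ℕ) (s : ℝ) :
    gramFun N n (-s) = (-1) ^ n * gramFun N n s := by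
  induction n using Nat.twoStepInduction with
  | zero => simp [gramFun]
  | one => simp [gramFun, neg_div]
  | more n h0 h1 =>
    rw [gramFun, gramFun, h0, h1]
    ring

theorem gramFun_difference_equation {N : ℝ} (hN : 0 ≤ N) (n : ℕ) (s : ℝ) :
    (N ^ 2 - (s + 1) ^ 2) * (gramFun N n (s + 2) - gramFun N n s)
      - (N ^ 2 - (s - 1) ^ 2) * (gramFun N n s - gramFun N n (s - 2)) =
      -(4 * n * (n + 1)) * gramFun N n s := by
  obtain ⟨h, -⟩ := gramFun_backward hN n s
  obtain ⟨h', -⟩ := gramFun_backward hN n (-s)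
  rw [show -s - 2 = -(s + 2) by ring, gramFun_neg, gramFun_neg, gramFun_neg] at h'
  have hsq : ((-1 : ℝ) ^ n) * (-1) ^ n = 1 := by rw [← mul_pow]; simp
  have h'' : (N ^ 2 - (s + 1) ^ 2) * (gramFun N n s - gramFun N n (s + 2)) =
      2 * (n + 1) * ((n - s) * gramFun N n s + (N + n + 1) * gramFun N (n + 1) s) := by
    rw [pow_succ] at h'
    linear_combination (-1) ^ n * h' + (2 * (n + 1) * ((n - s) * gramFun N n s
      + (N + n + 1) * gramFun N (n + 1) s) - (N ^ 2 - (s + 1) ^ 2) * (gramFun N n s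
      - gramFun N n (s + 2))) * hsq
  linear_combination -h'' - h

/-- Sum over the nodes `-(N-1), -(N-3), …, N-1`. -/
noncomputable def gridSum (N : ℕ) (f : ℝ → ℝ) : ℝ :=
  ∑ j ∈ Finset.range N, f (2 * j - N + 1)

theorem gridSum_gramFun_mul_of_ne (N : ℕ) {n m : ℕ} (hnm : n ≠ m) :
    gridSum N (fun s => gramFun N n s * gramFun N m s) = 0 := by
  have hN : (0 : ℝ) ≤ N := Nat.cast_nonneg N
  set W : ℕ → ℝ := fun j => ((N : ℝ) ^ 2 - (2 * j - N) ^ 2) *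
    (gramFun N n (2 * j - N - 1) * gramFun N m (2 * j - N + 1)
      - gramFun N n (2 * j - N + 1) * gramFun N m (2 * j - N - 1)) with hW
  have hstep : ∀ j : ℕ, (4 * ((n : ℝ) * (n + 1) - m * (m + 1))) *
      (gramFun N n (2 * j - N + 1) * gramFun N m (2 * j - N + 1)) = W (j + 1) - W j := by
    intro j
    have h1 := gramFun_difference_equation hN n (2 * j - N + 1)
    have h2 := gramFun_difference_equation hN m (2 * j - N + 1)
    simp only [hW]
    push_cast
    rw [show (2 * (j : ℝ) - N + 1 + 2) = 2 * (j + 1) - N + 1 by ring,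
      show (2 * (j : ℝ) - N + 1 - 2) = 2 * j - N - 1 by ring] at h1 h2
    rw [show (2 * ((j : ℝ) + 1) - N - 1) = 2 * j - N + 1 by ring]
    linear_combination gramFun N m (2 * j - N + 1) * h1 - gramFun N n (2 * j - N + 1) * h2
  have hsum : (4 * ((n : ℝ) * (n + 1) - m * (m + 1))) *
      gridSum N (fun s => gramFun N n s * gramFun N m s) = 0 := by
    rw [gridSum, Finset.mul_sum, Finset.sum_congr rfl (fun j _ => hstep j),
      Finset.sum_range_sub]
    simp only [hW, Nat.cast_zero]
    ring
  refine (mul_eq_zero.mp hsum).resolve_left ?_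
  have h1 : (n : ℝ) - m ≠ 0 := sub_ne_zero.mpr (by exact_mod_cast hnm)
  have h2 : (n : ℝ) + m + 1 ≠ 0 := by positivity
  have : (4 * ((n : ℝ) * (n + 1) - m * (m + 1))) = 4 * (((n : ℝ) - m) * (n + m + 1)) := by ring
  rw [this]
  exact mul_ne_zero four_ne_zero (mul_ne_zero h1 h2)

theorem gridSum_gramFun_sq_zero (N : ℕ) : gridSum N (fun s => gramFun N 0 s ^ 2) = N := by
  simp [gridSum, gramFun]

theorem gramFun_recurrence {N : ℝ} (hN : 0 ≤ N) (n : ℕ) (s : ℝ) :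
    (2 * (n : ℝ) + 1) * s * gramFun N n s = (n + 1) * (N + (n + 1)) * gramFun N (n + 1) s
      + n * (N - n) * gramFun N (n - 1) s := by
  cases n with
  | zero =>
    have := gramFun_one hN s
    simp only [Nat.cast_zero, gramFun_zero, zero_add]
    linear_combination -this
  | succ n =>
    have := gramFun_succ_succ hN n s
    push_cast
    linear_combination -this

theorem gridSum_gramFun_sq_succ (N n : ℕ) :
    (2 * (n : ℝ) + 3) * (N + (n + 1)) * gridSum N (fun s => gramFun N (n + 1) s ^ 2) =
      (2 * n + 1) * (N - (n + 1)) * gridSum N (fun s => gramFun N n s ^ 2) := by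
  have hN : (0 : ℝ) ≤ N := Nat.cast_nonneg N
  have o1 := gridSum_gramFun_mul_of_ne N (show n + 2 ≠ n by omega)
  have o2 : n * (N - (n : ℝ)) *
      gridSum N (fun s => gramFun N (n - 1) s * gramFun N (n + 1) s) = 0 := by
    cases n with
    | zero => simp
    | succ k => rw [gridSum_gramFun_mul_of_ne N (by omega), mul_zero]
  have e : ∀ s, (n + 1) * ((2 * (n : ℝ) + 3) * (N + (n + 1)) * gramFun N (n + 1) s ^ 2 -
      (2 * n + 1) * (N - (n + 1)) * gramFun N n s ^ 2) =
      (2 * n + 1) * ((n + 2) * (N + (n + 2))) * (gramFun N (n + 2) s * gramFun N n s)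
      - (2 * n + 3) * (n * (N - n) * (gramFun N (n - 1) s * gramFun N (n + 1) s)) := by
    intro s
    have h1 := gramFun_recurrence hN n s
    have h2 := gramFun_succ_succ hN n s
    linear_combination (-(2 * n + 3) * gramFun N (n + 1) s) * h1
      - (2 * n + 1) * gramFun N n s * h2
  have hp : ((n : ℝ) + 1) ≠ 0 := by positivity
  rw [← sub_eq_zero]
  apply mul_left_cancel₀ hp
  rw [mul_zero]
  have := Finset.sum_congr (rfl : Finset.range N = Finset.range N)
    (fun j _ => e (2 * (j : ℝ) - N + 1))
  simp only [gridSum] at o1 o2 ⊢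
  rw [← Finset.mul_sum, Finset.sum_sub_distrib, Finset.sum_sub_distrib] at this
  simp only [← Finset.mul_sum] at this
  rw [this, o1, o2]
  ring

theorem Polynomial.exists_eval_eq_sum_gramFun {N : ℝ} (hN : 0 ≤ N) (d : ℕ) :
    ∀ p : ℝ[X], p.natDegree ≤ d →
      ∃ c : ℕ → ℝ, ∀ s, p.eval s = ∑ i ∈ Finset.range (d + 1), c i * gramFun N i s := by
  let V : ℕ → Submodule ℝ (ℝ → ℝ) := fun d =>
    Submodule.span ℝ (gramFun N '' (Finset.range (d + 1) : Set ℕ))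
  have hmem : ∀ {i d}, i ≤ d → gramFun N i ∈ V d := fun {i d} h =>
    Submodule.subset_span ⟨i, by simpa [Nat.lt_succ_iff] using h, rfl⟩
  have hmul : ∀ d, ∀ f ∈ V d, (fun s => s * f s) ∈ V (d + 1) := by
    intro d f hf
    induction hf using Submodule.span_induction with
    | mem f hf =>
      obtain ⟨i, hi, rfl⟩ := hf
      have hi : i ≤ d := by simpa [Nat.lt_succ_iff] using hi
      have : (fun s => s * gramFun N i s) =
          ((2 * (i : ℝ) + 1)⁻¹ * ((i + 1) * (N + (i + 1)))) • gramFun N (i + 1)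
          + ((2 * (i : ℝ) + 1)⁻¹ * (i * (N - i))) • gramFun N (i - 1) := by
        funext s
        have h := gramFun_recurrence hN i s
        have hp : (2 * (i : ℝ) + 1) ≠ 0 := by positivity
        simp only [Pi.add_apply, Pi.smul_apply, smul_eq_mul]
        field_simp
        linear_combination h
      rw [this]
      exact add_mem (Submodule.smul_mem _ _ (hmem (by omega)))
        (Submodule.smul_mem _ _ (hmem (by omega)))
    | zero =>
      convert (V (d + 1)).zero_mem using 1
      funext s
      simp
    | add f g _ _ hf hg =>
      convert add_mem hf hg using 1
      funext s
      simp [mul_add]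
    | smul a f _ hf =>
      convert Submodule.smul_mem _ a hf using 1
      funext s
      simp only [Pi.smul_apply, smul_eq_mul]
      ring
  have hV : ∀ d, ∀ p : ℝ[X], p.natDegree ≤ d → (fun s => p.eval s) ∈ V d := by
    intro d
    induction d with
    | zero =>
      intro p hp
      rw [eq_C_of_natDegree_le_zero hp]
      convert Submodule.smul_mem _ (p.coeff 0) (hmem (le_refl 0)) using 1
      funext s
      simp [gramFun_zero]
    | succ d ih =>
      intro p hp
      have h1 := hmul d _ (ih p.divX (by rw [natDegree_divX_eq_natDegree_tsub_one]; omega))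
      convert add_mem h1 (Submodule.smul_mem _ (p.coeff 0) (hmem (Nat.zero_le (d + 1)))) using 1
      funext s
      have := congrArg (Polynomial.eval s) (X_mul_divX_add p)
      rw [eval_add, eval_mul, eval_X, eval_C] at this
      simp only [Pi.add_apply, Pi.smul_apply, smul_eq_mul, gramFun_zero, mul_one]
      exact this.symm
  intro p hp
  obtain ⟨c, hc⟩ := (Submodule.mem_span_image_finset_iff_exists_fun ℝ).mp (hV d p hp)
  refine ⟨fun i => if h : i ∈ Finset.range (d + 1) then c ⟨i, h⟩ else 0, fun s => ?_⟩
  rw [← congrFun hc s, Finset.sum_apply, ← Finset.sum_coe_sort (Finset.range (d + 1)) (fun i =>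
    (if h : i ∈ Finset.range (d + 1) then c ⟨i, h⟩ else 0) * gramFun N i s)]
  refine Finset.sum_congr rfl fun i _ => ?_
  rw [dif_pos i.2]
  rfl

theorem gridSum_sq_sum_gramFun (N d : ℕ) (c : ℕ → ℝ) :
    gridSum N (fun s => (∑ i ∈ Finset.range (d + 1), c i * gramFun N i s) ^ 2) =
      ∑ i ∈ Finset.range (d + 1), c i ^ 2 * gridSum N (fun s => gramFun N i s ^ 2) := by
  have h : ∀ i ∈ Finset.range (d + 1), c i ^ 2 * gridSum N (fun s => gramFun N i s ^ 2) =
      ∑ k ∈ Finset.range (d + 1),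
        c i * c k * gridSum N (fun s => gramFun N i s * gramFun N k s) := by
    intro i hi
    rw [Finset.sum_eq_single_of_mem i hi]
    · simp only [sq]
    · intro k _ hk
      rw [gridSum_gramFun_mul_of_ne N hk.symm, mul_zero]
  rw [Finset.sum_congr rfl h]
  simp only [gridSum, sq, Finset.sum_mul_sum]
  simp only [Finset.mul_sum]
  rw [Finset.sum_comm]
  refine Finset.sum_congr rfl fun i _ => ?_
  rw [Finset.sum_comm]
  refine Finset.sum_congr rfl fun k _ => Finset.sum_congr rfl fun j _ => ?_
  ring

theorem Polynomial.sq_eval_le_gridSum (N d : ℕ)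
    (hpos : ∀ i ≤ d, 0 < gridSum N (fun s => gramFun N i s ^ 2))
    (p : ℝ[X]) (hp : p.natDegree ≤ d) {s : ℝ} (hs : |s| ≤ N) :
    p.eval s ^ 2 ≤ (∑ i ∈ Finset.range (d + 1), (gridSum N (fun s => gramFun N i s ^ 2))⁻¹) *
      gridSum N (fun s => p.eval s ^ 2) := by
  obtain ⟨c, hc⟩ := p.exists_eval_eq_sum_gramFun (Nat.cast_nonneg N) d hp
  simp only [hc]
  rw [gridSum_sq_sum_gramFun]
  have hpos' : ∀ i ∈ Finset.range (d + 1), 0 < gridSum N (fun s => gramFun N i s ^ 2) :=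
    fun i hi => hpos i (by simpa [Nat.lt_succ_iff] using hi)
  refine Finset.sum_sq_le_sum_mul_sum_of_sq_le_mul _ (fun i hi => (inv_pos.mpr (hpos' i hi)).le)
    (fun i hi => mul_nonneg (sq_nonneg _) (hpos' i hi).le) fun i hi => ?_
  have h1 := gramFun_sq_le_one (Nat.cast_nonneg N) i hs
  have h2 := (hpos' i hi).ne'
  rw [mul_comm (c i ^ 2), inv_mul_cancel_left₀ h2, mul_pow]
  exact mul_le_of_le_one_right (sq_nonneg _) h1

theorem two_mul_Cconst_tangent_le {x y : ℝ} (hx0 : 0 ≤ x) (hx : x < 1) (hy0 : 0 ≤ y)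
    (hy : y < 1) :
    2 * Cconst x + (y - x) * Real.log ((1 + x) / (1 - x)) ≤ 2 * Cconst y := by
  have a1 : 0 < 1 + x := by linarith
  have a2 : 0 < 1 - x := by linarith
  have b1 : 0 < 1 + y := by linarith
  have b2 : 0 < 1 - y := by linarith
  have h1 := Real.log_le_sub_one_of_pos (div_pos a1 b1)
  have h2 := Real.log_le_sub_one_of_pos (div_pos a2 b2)
  rw [Real.log_div a1.ne' b1.ne'] at h1
  rw [Real.log_div a2.ne' b2.ne'] at h2
  have h3 := mul_le_mul_of_nonneg_left h1 b1.le
  have h4 := mul_le_mul_of_nonneg_left h2 b2.le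
  have e1 : (1 + y) * ((1 + x) / (1 + y) - 1) = x - y := by field_simp; ring
  have e2 : (1 - y) * ((1 - x) / (1 - y) - 1) = y - x := by field_simp; ring
  rw [Real.log_div a1.ne' a2.ne', Cconst, Cconst]
  linarith

theorem le_gridSum_gramFun_sq {N : ℕ} (hN : 0 < N) (n : ℕ) (hn : n < N) :
    (N : ℝ) ≤ (2 * n + 1) * gridSum N (fun s => gramFun N n s ^ 2) *
      Real.exp (N * (2 * Cconst (n / N)) + Real.log ((1 + n / N) / (1 - n / N))) := by
  induction n with
  | zero => simp [gridSum_gramFun_sq_zero, Cconst]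
  | succ n ih =>
    have hN' : (0 : ℝ) < N := by exact_mod_cast hN
    have hlt : (n : ℝ) + 1 < N := by exact_mod_cast hn
    refine (ih (by omega)).trans ?_
    have h := gridSum_gramFun_sq_succ N n
    have hH : 0 ≤ gridSum N (fun s => gramFun N n s ^ 2) :=
      Finset.sum_nonneg fun _ _ => sq_nonneg _
    set H := gridSum N (fun s => gramFun N n s ^ 2)
    set H' := gridSum N (fun s => gramFun N (n + 1) s ^ 2)
    push_cast
    have p1 : 0 < (N : ℝ) + (n + 1) := by positivity
    have p2 : 0 < (N : ℝ) - (n + 1) := by linarith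
    have q : ((1 + ((n : ℝ) + 1) / N) / (1 - (n + 1) / N)) = (N + (n + 1)) / (N - (n + 1)) := by
      have : 1 - ((n : ℝ) + 1) / N = (N - (n + 1)) / N := by field_simp
      rw [this]
      field_simp
    have hlt1 : ((n : ℝ) + 1) / N < 1 := (div_lt_one hN').mpr hlt
    have tan := two_mul_Cconst_tangent_le (x := n / N) (y := (n + 1) / N) (by positivity)
      ((div_lt_one hN').mpr (by linarith)) (by positivity) hlt1
    have tan' : N * (2 * Cconst (n / N)) + Real.log ((1 + n / N) / (1 - n / N)) ≤
        N * (2 * Cconst ((n + 1) / N)) := by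
      have := mul_le_mul_of_nonneg_left tan hN'.le
      have e : (N : ℝ) * (((n : ℝ) + 1) / N - n / N) = 1 := by field_simp; ring
      rw [mul_add, ← mul_assoc (N : ℝ) (_ - _), e, one_mul] at this
      exact this
    rw [q, Real.exp_add _ (Real.log ((N + (n + 1)) / (N - (n + 1)))),
      Real.exp_log (div_pos p1 p2)]
    have e : (2 * ((n : ℝ) + 1) + 1) * H' * (Real.exp (N * (2 * Cconst ((n + 1) / N))) *
        ((N + (n + 1)) / (N - (n + 1)))) =
        (2 * n + 1) * H * Real.exp (N * (2 * Cconst ((n + 1) / N))) := by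
      have := p2.ne'
      field_simp
      linear_combination h
    rw [e]
    gcongr

theorem Cconst_add_log_le {α x : ℝ} (hx0 : 0 ≤ x) (hx : x ≤ α) (hα : α < 1) {N : ℝ}
    (hN : 0 ≤ N) :
    N * (2 * Cconst x) + Real.log ((1 + x) / (1 - x)) ≤
      N * (2 * Cconst α) + Real.log ((1 + α) / (1 - α)) := by
  have h1 := two_mul_Cconst_tangent_le hx0 (hx.trans_lt hα) (hx0.trans hx) hα
  have p1 : 0 < 1 - x := by linarith
  have p2 : 0 < 1 - α := by linarith
  have h2 : 0 ≤ Real.log ((1 + x) / (1 - x)) :=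
    Real.log_nonneg ((one_le_div p1).mpr (by linarith))
  have h3 : Real.log ((1 + x) / (1 - x)) ≤ Real.log ((1 + α) / (1 - α)) := by
    apply Real.log_le_log (by positivity)
    exact div_le_div₀ (by linarith) (by linarith) p2 (by linarith)
  have h4 : 2 * Cconst x ≤ 2 * Cconst α := by nlinarith
  have := mul_le_mul_of_nonneg_left h4 hN
  linarith

theorem gridSum_gramFun_sq_bounds {α : ℝ} (hα : α ∈ Set.Ioo (0 : ℝ) 1) {N : ℕ} (hN : 0 < N)
    {n : ℕ} (hn : (n : ℝ) ≤ α * N) :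
    0 < gridSum N (fun s => gramFun N n s ^ 2) ∧
    (gridSum N (fun s => gramFun N n s ^ 2))⁻¹ ≤
      3 * Real.exp (N * (2 * Cconst α) + Real.log ((1 + α) / (1 - α))) := by
  have hN' : (0 : ℝ) < N := by exact_mod_cast hN
  have hlt : (n : ℝ) < N := by nlinarith [hα.2]
  have h := le_gridSum_gramFun_sq hN n (by exact_mod_cast hlt)
  have hH : 0 ≤ gridSum N (fun s => gramFun N n s ^ 2) :=
    Finset.sum_nonneg fun _ _ => sq_nonneg _
  set H := gridSum N (fun s => gramFun N n s ^ 2)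
  have hpos : 0 < H := by
    rcases hH.eq_or_lt with h0 | h0
    · rw [← h0] at h
      simp at h
      omega
    · exact h0
  refine ⟨hpos, ?_⟩
  have hx : (n : ℝ) / N ≤ α := (div_le_iff₀ hN').mpr hn
  have hexp := Real.exp_le_exp.mpr
    (Cconst_add_log_le (by positivity : 0 ≤ (n : ℝ) / N) hx hα.2 hN'.le)
  rw [inv_le_iff_one_le_mul₀' hpos]
  refine le_of_mul_le_mul_left ?_ hN'
  set E := Real.exp (N * (2 * Cconst α) + Real.log ((1 + α) / (1 - α)))
  have h2 : (N : ℝ) ≤ (2 * n + 1) * H * E := h.trans (by gcongr)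
  have h1N : (1 : ℝ) ≤ N := by exact_mod_cast hN
  have h3 : (2 * (n : ℝ) + 1) * H * E ≤ (3 * N) * H * E := by
    have : 2 * (n : ℝ) + 1 ≤ 3 * N := by linarith
    gcongr
  linarith

theorem finite_nGrid (n : ℕ) : (nGrid n).Finite := by
  refine ((Set.finite_Icc 1 n).image
    (fun k : ℕ => (2 * (k : ℝ) - n - 1) / ((n : ℝ) - 1))).subset ?_
  rintro x ⟨k, h1, h2, rfl⟩
  exact ⟨k, ⟨h1, h2⟩, rfl⟩

theorem abs_eval_le_normE {n : ℕ} (p : ℝ[X]) {x : ℝ} (hx : x ∈ nGrid n) :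
    |p.eval x| ≤ normE n p :=
  le_csSup ((finite_nGrid n).image _).bddAbove ⟨x, hx, rfl⟩

theorem normE_nonneg (n : ℕ) (p : ℝ[X]) : 0 ≤ normE n p :=
  Real.sSup_nonneg (by rintro _ ⟨x, -, rfl⟩; exact abs_nonneg _)

/-- An explicit upper bound for the square of `normI p / normE n p` when `deg p ≤ α n`. -/
noncomputable def ratioSqBound (α : ℝ) (n : ℕ) : ℝ :=
  3 * (n : ℝ) ^ 2 * Real.exp (n * (2 * Cconst α) + Real.log ((1 + α) / (1 - α)))

theorem normI_le_mul_normE {α : ℝ} (hα : α ∈ Set.Ioo (0 : ℝ) 1) {n : ℕ} (hn : 2 ≤ n)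
    (p : ℝ[X]) (hp : (p.natDegree : ℝ) ≤ α * n) :
    normI p ≤ Real.sqrt (ratioSqBound α n) * normE n p := by
  have hn' : (2 : ℝ) ≤ n := by exact_mod_cast hn
  have hn1 : (n : ℝ) - 1 ≠ 0 := by linarith
  have hbounds : ∀ i ≤ p.natDegree, _ := fun i hi =>
    gridSum_gramFun_sq_bounds hα (n := i) (show 0 < n by omega)
      (le_trans (by exact_mod_cast hi) hp)
  apply csSup_le ((Set.nonempty_Icc.mpr (by norm_num)).image _)
  rintro _ ⟨x, hx, rfl⟩
  have hx' : |x| ≤ 1 := abs_le.mpr hx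
  set q := p.comp (C ((n : ℝ) - 1)⁻¹ * X) with hq
  have heval : ∀ s, q.eval s = p.eval (s / (n - 1)) := fun s => by
    simp [hq, div_eq_inv_mul]
  have hdeg : q.natDegree ≤ p.natDegree := by
    rw [hq, natDegree_comp]
    exact (Nat.mul_le_mul_left _ ((natDegree_C_mul_le _ _).trans natDegree_X_le)).trans_eq
      (mul_one _)
  have hs : |((n : ℝ) - 1) * x| ≤ n := by
    rw [abs_mul, abs_of_nonneg (by linarith)]
    nlinarith [abs_nonneg x]
  have key := q.sq_eval_le_gridSum n p.natDegree (fun i hi => (hbounds i hi).1) hdeg hs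
  rw [heval, mul_div_cancel_left₀ _ hn1] at key
  have hgrid : gridSum n (fun s => q.eval s ^ 2) ≤ n * normE n p ^ 2 := by
    rw [gridSum]
    refine (Finset.sum_le_card_nsmul _ _ (normE n p ^ 2) fun j hj => ?_).trans (by simp)
    rw [heval, ← sq_abs]
    have : (2 * (j : ℝ) - n + 1) / (n - 1) ∈ nGrid n := by
      refine ⟨j + 1, by omega, by simpa using hj, ?_⟩
      push_cast
      ring
    exact pow_le_pow_left₀ (abs_nonneg _) (abs_eval_le_normE p this) 2
  have hlt : (p.natDegree : ℝ) < n := by nlinarith [hα.2]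
  have hle : (p.natDegree : ℝ) + 1 ≤ n := by exact_mod_cast hlt
  set E := Real.exp (n * (2 * Cconst α) + Real.log ((1 + α) / (1 - α))) with hE
  have hsum : ∑ i ∈ Finset.range (p.natDegree + 1),
      (gridSum n (fun s => gramFun n i s ^ 2))⁻¹ ≤ n * (3 * E) := by
    refine (Finset.sum_le_card_nsmul _ _ (3 * E) fun i hi =>
      (hbounds i (by simpa [Nat.lt_succ_iff] using hi)).2).trans ?_
    simp only [Finset.card_range, nsmul_eq_mul]
    push_cast
    gcongr
  have hfinal : p.eval x ^ 2 ≤ ratioSqBound α n * normE n p ^ 2 := by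
    calc p.eval x ^ 2 ≤ _ := key
      _ ≤ (n * (3 * E)) * (n * normE n p ^ 2) := by
          apply mul_le_mul hsum hgrid (Finset.sum_nonneg fun _ _ => sq_nonneg _)
          positivity
      _ = _ := by rw [ratioSqBound]; ring
  have h := Real.sqrt_le_sqrt hfinal
  rwa [Real.sqrt_sq_eq_abs, Real.sqrt_mul' _ (sq_nonneg _),
    Real.sqrt_sq (normE_nonneg n p)] at h

theorem normI_one : normI 1 = 1 := by
  have : (Set.Icc (-1 : ℝ) 1).Nonempty := Set.nonempty_Icc.mpr (by norm_num)
  simp [normI, this.image_const]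

theorem normE_one {n : ℕ} (hn : 1 ≤ n) : normE n 1 = 1 := by
  have : (nGrid n).Nonempty := ⟨_, 1, le_rfl, hn, rfl⟩
  simp [normE, this.image_const]

theorem tendsto_log_ratioSqBound (α : ℝ) :
    Tendsto (fun n : ℕ => (n : ℝ)⁻¹ * Real.log (Real.sqrt (ratioSqBound α n))) atTop
      (nhds (Cconst α)) := by
  have hlog : Tendsto (fun n : ℕ => Real.log n / n) atTop (nhds 0) := by
    have := (Real.isLittleO_log_id_atTop.tendsto_div_nhds_zero).comp tendsto_natCast_atTop_atTop
    simpa [Function.comp_def] using this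
  have hinv : Tendsto (fun n : ℕ => (n : ℝ)⁻¹) atTop (nhds 0) :=
    tendsto_inv_atTop_nhds_zero_nat
  have hlim := (hlog.add (hinv.const_mul
    ((Real.log 3 + Real.log ((1 + α) / (1 - α))) / 2))).add_const (Cconst α)
  simp only [mul_zero, add_zero, zero_add] at hlim
  refine hlim.congr' ?_
  filter_upwards [eventually_ge_atTop 1] with n hn
  have hn0 : (n : ℝ) ≠ 0 := by positivity
  rw [ratioSqBound, Real.log_sqrt (by positivity), Real.log_mul (by positivity) (by positivity),
    Real.log_mul (by positivity) (by positivity), Real.log_pow, Real.log_exp]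
  field_simp
  push_cast
  ring

theorem extremal_ratio_limsup (α : ℝ) (hα : α ∈ Set.Ioo (0 : ℝ) 1) :
    Filter.limsup (fun n : ℕ =>
        (n : ℝ)⁻¹ * Real.log (sSup {t : ℝ | ∃ p : Polynomial ℝ, p ≠ 0 ∧
          (p.natDegree : ℝ) ≤ α * n ∧ t = normI p / normE n p})) atTop ≤ Cconst α := by
  set S : ℕ → Set ℝ := fun n => {t : ℝ | ∃ p : Polynomial ℝ, p ≠ 0 ∧
    (p.natDegree : ℝ) ≤ α * n ∧ t = normI p / normE n p}
  have hub : ∀ n ≥ 2, ∀ t ∈ S n, t ≤ Real.sqrt (ratioSqBound α n) := by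
    rintro n hn _ ⟨p, -, hp, rfl⟩
    exact div_le_of_le_mul₀ (normE_nonneg n p) (Real.sqrt_nonneg _)
      (normI_le_mul_normE hα hn p hp)
  have hone : ∀ n ≥ 2, 1 ∈ S n := fun n hn =>
    ⟨1, one_ne_zero, by simpa using mul_nonneg hα.1.le (Nat.cast_nonneg n),
      by rw [normI_one, normE_one (by omega), div_one]⟩
  have hge : ∀ n ≥ 2, 1 ≤ sSup (S n) := fun n hn => le_csSup ⟨_, hub n hn⟩ (hone n hn)
  have hlim := tendsto_log_ratioSqBound α
  rw [← hlim.limsup_eq]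
  refine limsup_le_limsup ?_ ?_ hlim.isBoundedUnder_le
  · filter_upwards [eventually_ge_atTop 2] with n hn
    have := hge n hn
    exact mul_le_mul_of_nonneg_left (Real.log_le_log (by linarith)
      (csSup_le ⟨1, hone n hn⟩ (hub n hn))) (by positivity)
  · refine IsBoundedUnder.isCoboundedUnder_le ⟨0, ?_⟩
    rw [eventually_map]
    filter_upwards [eventually_ge_atTop 2] with n hn
    exact mul_nonneg (by positivity) (Real.log_nonneg (hge n hn))
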